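/- For any n ∈ ℕ and any z ∈ V, the probability P_{s_0}(|s_τ| = n) converges, as |s_0| → −∞, to (1/κ)·#{ρ ∈ Rec(z) : |ρ| = n}. -/

import Mathlib

open scoped BigOperators
open Classical Filter

noncomputable section

namespace ThresholdState

variable {V : Type*} [Fintype V] [DecidableEq V]

/-- `A i j` is the number of directed edges from `i` to `j`. -/
def outdeg (A : V → V → ℕ) (i : V) : ℕ := ∑ j, A i j

def indeg (A : V → V → ℕ) (i : V) : ℕ := ∑ j, A j i

/-- Eulerian: out-degree equals in-degree at every vertex. -/
def Eulerian (A : V → V → ℕ) : Prop := ∀ i, outdeg A i = indeg A i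

/-- (Strongly) connected multigraph. -/
def Connected (A : V → V → ℕ) : Prop :=
  ∀ i j : V, Relation.ReflTransGen (fun a b => 0 < A a b) i j

def deg (A : V → V → ℕ) (i : V) : ℕ := outdeg A i

/-- Graph Laplacian: `Δu(i) = -deg(i)·u(i) + Σ_{e incoming to i} u(e⁻)`. -/
def lap (A : V → V → ℕ) (u : V → ℤ) (i : V) : ℤ :=
  -(deg A i : ℤ) * u i + ∑ j, (A j i : ℤ) * u j

def delta (z : V) : V → ℤ := fun j => if j = z then 1 else 0

/-- Toppling vertex `i`: replace `s` by `s + Δδ_i`. -/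
def toppleAt (A : V → V → ℕ) (s : V → ℤ) (i : V) : V → ℤ :=
  fun j => s j + lap A (delta i) j

def applySeq (A : V → V → ℕ) (s : V → ℤ) (l : List V) : V → ℤ :=
  l.foldl (toppleAt A) s

/-- A legal toppling sequence (avoiding the forbidden set `F`): each toppled
vertex is unstable when toppled and does not lie in `F`. -/
def ValidSeq (A : V → V → ℕ) (F : V → Prop) : (V → ℤ) → List V → Prop
  | _, [] => True
  | s, i :: l => ¬ F i ∧ (deg A i : ℤ) ≤ s i ∧ ValidSeq A F (toppleAt A s i) l

/-- Stable at every non-forbidden vertex. -/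
def StableOff (A : V → V → ℕ) (F : V → Prop) (s : V → ℤ) : Prop :=
  ∀ i, ¬ F i → s i ≤ (deg A i : ℤ) - 1

def StabilizesTo (A : V → V → ℕ) (F : V → Prop) (s : V → ℤ) (l : List V) : Prop :=
  ValidSeq A F s l ∧ StableOff A F (applySeq A s l)

def StabilizableVia (A : V → V → ℕ) (F : V → Prop) (s : V → ℤ) : Prop :=
  ∃ l, StabilizesTo A F s l

/-- Stabilizable with no forbidden vertices. -/
def Stabilizable (A : V → V → ℕ) (s : V → ℤ) : Prop :=
  StabilizableVia A (fun _ => False) s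

def stabSeq (A : V → V → ℕ) (F : V → Prop) (s : V → ℤ) : List V :=
  if h : StabilizableVia A F s then h.choose else []

def stabilizeVia (A : V → V → ℕ) (F : V → Prop) (s : V → ℤ) : V → ℤ :=
  applySeq A s (stabSeq A F s)

/-- Odometer: number of topplings at each vertex (`0` everywhere if not stabilizable). -/
def odometerVia (A : V → V → ℕ) (F : V → Prop) (s : V → ℤ) : V → ℕ :=
  fun i => (stabSeq A F s).count i

def sinkStabilize (A : V → V → ℕ) (z : V) (s : V → ℤ) : V → ℤ :=
  stabilizeVia A (fun i => i = z) s

def sinkOdometer (A : V → V → ℕ) (z : V) (s : V → ℤ) : V → ℕ :=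
  odometerVia A (fun i => i = z) s

/-- `ρ` is `z`-recurrent (Dhar's burning test): `ρ(z) = deg z`, `ρ(i) ≤ deg i - 1`
off the sink, and every site other than `z` topples exactly once in the
stabilization of `ρ + Δδ_z` with sink `z`. -/
def ZRec (A : V → V → ℕ) (z : V) (ρ : V → ℤ) : Prop :=
  ρ z = (deg A z : ℤ) ∧ (∀ i, i ≠ z → ρ i ≤ (deg A i : ℤ) - 1) ∧
  ∃ l : List V, StabilizesTo A (fun i => i = z) (fun j => ρ j + lap A (delta z) j) l ∧
    ∀ i, i ≠ z → l.count i = 1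

/-- `κ` = number of `z`-recurrent sandpiles. -/
def kappa (A : V → V → ℕ) (z : V) : ℕ := Nat.card {ρ : V → ℤ // ZRec A z ρ}

def totalMass (s : V → ℤ) : ℤ := ∑ i, s i

/-- Open addition operator `â_i` (with sink `z`). -/
def openAdd (A : V → V → ℕ) (z i : V) (ρ : V → ℤ) : V → ℤ :=
  fun j => if j = z then (deg A z : ℤ) else sinkStabilize A z (fun k => ρ k + delta i k) j

/-- `â_i⁻¹` on `Rec(z)`. -/
def openAddInv (A : V → V → ℕ) (z i : V) (ρ : V → ℤ) : V → ℤ :=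
  if h : ∃ ρ', ZRec A z ρ' ∧ openAdd A z i ρ' = ρ then h.choose else ρ

/-- Burst size `av_{i→z}(ρ) = |â_i⁻¹ρ| - |ρ| + 1`. -/
def burst (A : V → V → ℕ) (z i : V) (ρ : V → ℤ) : ℤ :=
  totalMass (openAddInv A z i ρ) - totalMass ρ + 1

/-- The `z`-recurrent decomposition `s = ρ + m·δ_z + Δv` with `ρ ∈ Rec(z)`, `v(z)=0`. -/
def ZDecomp (A : V → V → ℕ) (z : V) (s ρ : V → ℤ) (m : ℤ) (v : V → ℤ) : Prop :=
  ZRec A z ρ ∧ v z = 0 ∧ ∀ j, s j = ρ j + m * delta z j + lap A v j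

/-- `R_z(s)`: the `z`-recurrent representative of `s`. -/
def Rz (A : V → V → ℕ) (z : V) (s : V → ℤ) : V → ℤ :=
  if h : ∃ ρ, ∃ m, ∃ v, ZDecomp A z s ρ m v then h.choose else s

/-- `m_z(s)`: the integer in the `z`-recurrent decomposition of `s`. -/
def mz (A : V → V → ℕ) (z : V) (s : V → ℤ) : ℤ :=
  if h : ∃ m, ∃ ρ, ∃ v, ZDecomp A z s ρ m v then h.choose else 0

/-- Closed addition operator `a_i`. -/
def closedAdd (A : V → V → ℕ) (i : V) (s : V → ℤ) : V → ℤ :=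
  if Stabilizable A (fun j => s j + delta i j) then
    stabilizeVia A (fun _ => False) (fun j => s j + delta i j)
  else fun j => s j + delta i j

/-- The closed chain after making the additions listed in `w` (in order). -/
def chain (A : V → V → ℕ) (s0 : V → ℤ) (w : List V) : V → ℤ :=
  w.foldl (fun s i => closedAdd A i s) s0

/-- `w` is a threshold word for `s0`: the chain first becomes non-stabilizable
exactly after the additions in `w`, i.e. `τ = |w|` on the cylinder of `w`. -/
def IsThresholdWord (A : V → V → ℕ) (s0 : V → ℤ) (w : List V) : Prop :=
  ¬ Stabilizable A (chain A s0 w) ∧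
  ∀ w' : List V, w' <+: w → w' ≠ w → Stabilizable A (chain A s0 w')

def wordProb (α : V → ℝ) (w : List V) : ℝ := (w.map α).prod

/-- `P_{s0}(E at the threshold time)`: total probability of the (disjoint)
cylinders of threshold words satisfying `E`. -/
def thresholdProb (A : V → V → ℕ) (α : V → ℝ) (s0 : V → ℤ) (E : List V → Prop) : ℝ :=
  ∑' w : List V, if IsThresholdWord A s0 w ∧ E w then wordProb α w else 0

/-- `E_{s0}[f at the threshold time]`. -/
def thresholdExp (A : V → V → ℕ) (α : V → ℝ) (s0 : V → ℤ) (f : List V → ℝ) : ℝ :=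
  ∑' w : List V, if IsThresholdWord A s0 w then wordProb α w * f w else 0

end ThresholdState

namespace ThresholdState

section Sandpile

variable {V : Type*} [Fintype V]

section Laplacian

variable (A : V → V → ℕ)

theorem lap_add (u v : V → ℤ) : lap A (u + v) = lap A u + lap A v := by
  ext i
  simp only [lap, Pi.add_apply, mul_add, Finset.sum_add_distrib]
  ring

/-- The graph Laplacian as an additive homomorphism. -/
def lapHom : (V → ℤ) →+ (V → ℤ) := AddMonoidHom.mk' (lap A) (lap_add A)

@[simp] theorem lapHom_apply (u : V → ℤ) : lapHom A u = lap A u := rfl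

theorem lap_sub (u v : V → ℤ) : lap A (u - v) = lap A u - lap A v := map_sub (lapHom A) u v

theorem lap_neg (u : V → ℤ) : lap A (-u) = -lap A u := map_neg (lapHom A) u

theorem lap_zero : lap A 0 = 0 := map_zero (lapHom A)

/-- Green's identity for the Laplacian. -/
theorem sum_mul_lap (h u : V → ℤ) :
    ∑ i, h i * lap A u i = ∑ i, u i * ∑ j, (A i j : ℤ) * (h j - h i) := by
  simp only [lap, mul_add, Finset.sum_add_distrib, mul_sub, Finset.sum_sub_distrib,
    Finset.mul_sum, deg, outdeg]
  rw [Finset.sum_comm (f := fun i j => h i * ((A j i : ℤ) * u j)),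
    add_comm, sub_eq_add_neg, ← Finset.sum_neg_distrib]
  congr 1
  · exact Finset.sum_congr rfl fun i _ => Finset.sum_congr rfl fun j _ => by ring
  · refine Finset.sum_congr rfl fun i _ => ?_
    rw [← Finset.mul_sum, ← Finset.sum_mul]
    push_cast
    ring

theorem totalMass_lap (u : V → ℤ) : totalMass (lap A u) = 0 := by
  simpa [totalMass] using sum_mul_lap A (fun _ => 1) u

theorem totalMass_add (s t : V → ℤ) : totalMass (s + t) = totalMass s + totalMass t :=
  Finset.sum_add_distrib

variable {A}

theorem Eulerian.lap_eq (hA : Eulerian A) (u : V → ℤ) (i : V) :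
    lap A u i = ∑ j, (A j i : ℤ) * (u j - u i) := by
  have h : (deg A i : ℤ) = ∑ j, (A j i : ℤ) := by
    rw [deg, hA i, indeg]; push_cast; rfl
  simp only [lap, mul_sub, Finset.sum_sub_distrib, ← Finset.sum_mul, h]
  ring

theorem Eulerian.lap_const (hA : Eulerian A) (c : ℤ) : lap A (fun _ => c) = 0 := by
  ext i
  simp [hA.lap_eq]

end Laplacian

theorem sub_delta_nonneg {V : Type*} [DecidableEq V] {u : V → ℤ} (hu : 0 ≤ u) {i : V}
    (hi : 1 ≤ u i) : 0 ≤ u - delta i := by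
  intro j
  have := hu j
  simp only [Pi.sub_apply, delta, Pi.zero_apply] at *
  split_ifs with h
  · subst h; lia
  · lia

theorem one_le_of_unstable {A : V → V → ℕ} {F : V → Prop} {s u : V → ℤ} (hu : 0 ≤ u)
    {i : V} (hF : ¬ F i) (hi : (deg A i : ℤ) ≤ s i) (hs : StableOff A F (s + lap A u)) : 1 ≤ u i := by
  by_contra! hlt
  have h0 : u i = 0 := le_antisymm (by lia) (hu i)
  have h1 := hs i hF
  have h2 : 0 ≤ ∑ j, (A j i : ℤ) * u j :=
    Finset.sum_nonneg fun j _ => mul_nonneg (by positivity) (hu j)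
  simp only [Pi.add_apply, lap, h0] at h1
  lia

variable [DecidableEq V]

@[simp] theorem totalMass_delta (i : V) : totalMass (delta i) = 1 := by
  simp [totalMass, delta]

variable {A : V → V → ℕ} {F : V → Prop} {s : V → ℤ}

theorem toppleAt_eq (i : V) : toppleAt A s i = s + lap A (delta i) := rfl

theorem applySeq_eq (l : List V) :
    applySeq A s l = s + lap A (fun i => (l.count i : ℤ)) := by
  induction l generalizing s with
  | nil => exact (add_eq_left.2 (lap_zero A)).symm
  | cons i l ih =>
    have h : (fun j => ((i :: l).count j : ℤ)) = delta i + fun j => (l.count j : ℤ) := by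
      ext j
      simp only [List.count_cons, delta, Pi.add_apply, beq_iff_eq, eq_comm (a := i)]
      split_ifs <;> simp [add_comm]
    rw [h, lap_add, ← add_assoc, ← toppleAt_eq]
    exact ih

theorem toppleAt_add_lap_sub (u : V → ℤ) (i : V) :
    toppleAt A s i + lap A (u - delta i) = s + lap A u := by
  rw [toppleAt_eq, lap_sub]; abel

/-- Least action principle: a legal toppling sequence never topples more than a stabilizing
nonnegative function. -/
theorem ValidSeq.count_le {l : List V} (hl : ValidSeq A F s l) {u : V → ℤ} (hu : 0 ≤ u)
    (hs : StableOff A F (s + lap A u)) (i : V) : (l.count i : ℤ) ≤ u i := by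
  induction l generalizing s u with
  | nil => simpa using hu i
  | cons k l ih =>
    obtain ⟨hF, hk, hl⟩ := hl
    have h1 := one_le_of_unstable hu hF hk hs
    have h2 := ih hl (sub_delta_nonneg hu h1) (by rwa [toppleAt_add_lap_sub])
    simp only [Pi.sub_apply, delta] at h2
    rw [List.count_cons]
    simp only [beq_iff_eq, eq_comm (a := k)]
    split_ifs at h2 ⊢ <;> push_cast <;> lia

theorem stabilizableVia_of_stableOff {u : V → ℤ} (hu : 0 ≤ u)
    (hs : StableOff A F (s + lap A u)) : StabilizableVia A F s := by
  obtain ⟨n, hn⟩ : ∃ n : ℕ, totalMass u = n :=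
    Int.eq_ofNat_of_zero_le (Finset.sum_nonneg fun i _ => hu i)
  induction n generalizing s u with
  | zero =>
    have h0 : u = 0 := by
      ext i
      exact (Finset.sum_eq_zero_iff_of_nonneg fun i _ => hu i).1 hn i (Finset.mem_univ i)
    exact ⟨[], trivial, by simpa [h0, lap_zero, applySeq] using hs⟩
  | succ n ih =>
    by_cases hst : StableOff A F s
    · exact ⟨[], trivial, hst⟩
    · simp only [StableOff, not_forall] at hst
      obtain ⟨i, hF, hi⟩ := hst
      have hi' : (deg A i : ℤ) ≤ s i := by lia
      have h1 := one_le_of_unstable hu hF hi' hs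
      obtain ⟨l, hl, hl'⟩ := ih (s := toppleAt A s i) (sub_delta_nonneg hu h1)
        (by rwa [toppleAt_add_lap_sub]) (by
          have := totalMass_add (u - delta i) (delta i)
          rw [sub_add_cancel, totalMass_delta] at this
          push_cast at hn; lia)
      exact ⟨i :: l, ⟨hF, hi', hl⟩, hl'⟩

/-- On an Eulerian graph a sandpile is stabilizable iff it is equivalent to a stable one. -/
theorem Eulerian.stabilizable_iff (hA : Eulerian A) :
    Stabilizable A s ↔ ∃ u : V → ℤ, ∀ i, (s + lap A u) i ≤ (deg A i : ℤ) - 1 := by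
  constructor
  · rintro ⟨l, -, hl⟩
    exact ⟨_, fun i => by simpa [applySeq_eq] using hl i not_false⟩
  · rintro ⟨u, hu⟩
    refine stabilizableVia_of_stableOff (u := u + fun _ => ∑ j, |u j|) (fun i => ?_) ?_
    · have h1 := Finset.single_le_sum (f := fun j => |u j|) (fun j _ => abs_nonneg _)
        (Finset.mem_univ i)
      have h2 := neg_abs_le (u i)
      simp only [Pi.zero_apply, Pi.add_apply] at *
      lia
    · rw [lap_add, hA.lap_const, add_zero]
      exact fun i _ => hu i

theorem ZRec.le_of_stable {z : V} {ρ : V → ℤ} (hρ : ZRec A z ρ) (hA : Eulerian A) {m : ℤ}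
    {v : V → ℤ} (hs : ∀ i, i ≠ z → (ρ + m • delta z + lap A v) i ≤ (deg A i : ℤ) - 1) (i : V) :
    v z ≤ v i := by
  obtain ⟨-, -, l, ⟨hl, -⟩, hcount⟩ := hρ
  obtain ⟨k, -, hk⟩ := Finset.exists_min_image Finset.univ v ⟨z, Finset.mem_univ z⟩
  by_contra! hi
  have hkz : v k < v z := (hk i (Finset.mem_univ i)).trans_lt hi
  have hne : k ≠ z := by rintro rfl; exact lt_irrefl _ hkz
  have h := hl.count_le (u := v - (fun _ => v k) - delta z)
    (sub_delta_nonneg (fun j => sub_nonneg.2 (hk j (Finset.mem_univ j))) (by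
      lia)) (by
      intro j hj
      have := hs j hj
      rw [lap_sub, lap_sub, hA.lap_const]
      simp only [Pi.add_apply, Pi.smul_apply, delta, hj, Pi.sub_apply, Pi.zero_apply] at this ⊢
      simp at this
      unfold delta at *
      lia) k
  rw [hcount k hne] at h
  simp [delta, hne] at h

theorem ZRec.nonneg {z : V} {ρ : V → ℤ} (hρ : ZRec A z ρ) (hA : Eulerian A) : 0 ≤ ρ := by
  intro i
  by_contra! hi
  have hi : ρ i < 0 := hi
  have hz : i ≠ z := by rintro rfl; rw [hρ.1] at hi; lia
  have h := hρ.le_of_stable hA (m := 0) (v := -delta i) (fun j hj => by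
    rw [lap_neg]
    simp only [zero_smul, add_zero, Pi.add_apply, Pi.neg_apply, lap, delta, mul_ite, mul_one,
      mul_zero, Finset.sum_ite_eq', Finset.mem_univ, if_true]
    by_cases hji : j = i
    · subst hji
      simp only [if_true]
      lia
    · have := hρ.2.1 j hj
      simp only [hji, if_false]
      lia) i
  simp [delta, hz.symm] at h

theorem exists_rank {V : Type*} (r : V → V → Prop) (z : V)
    (h : ∀ i, Relation.ReflTransGen r i z) :
    ∃ d : V → ℕ, d z = 0 ∧ ∀ i, i ≠ z → ∃ j, r i j ∧ d j < d i := by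
  obtain ⟨P, hP0, hPs⟩ : ∃ P : ℕ → V → Prop, (∀ i, P 0 i ↔ i = z) ∧
      ∀ n i, P (n + 1) i ↔ ∃ j, r i j ∧ P n j :=
    ⟨fun n => Nat.rec (motive := fun _ => V → Prop) (fun i => i = z)
      (fun _ Q i => ∃ j, r i j ∧ Q j) n, fun _ => Iff.rfl, fun _ _ => Iff.rfl⟩
  have hP : ∀ i, ∃ n, P n i := fun i => by
    induction h i using Relation.ReflTransGen.head_induction_on with
    | refl => exact ⟨0, (hP0 z).2 rfl⟩
    | head hab _ ih => exact ih.imp' (· + 1) fun n hn => (hPs n _).2 ⟨_, hab, hn⟩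
  refine ⟨fun i => Nat.find (hP i), (Nat.find_eq_zero (hP z)).2 ((hP0 z).2 rfl), fun i hi => ?_⟩
  have hs := Nat.find_spec (hP i)
  rcases hn : Nat.find (hP i) with _ | n
  · rw [hn, hP0] at hs
    exact absurd hs hi
  · rw [hn, hPs] at hs
    obtain ⟨j, hij, hj⟩ := hs
    exact ⟨j, hij, (Nat.lt_succ_of_le (Nat.find_min' (hP j) hj)).trans_eq hn.symm⟩

/-- If every vertex can reach `z`, there is a nonnegative integer function vanishing at `z` that
is strictly superharmonic elsewhere. -/
theorem exists_superharmonic {V : Type*} [Fintype V] (B : V → V → ℕ) (z : V)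
    (hB : ∀ i, Relation.ReflTransGen (fun a b => 0 < B a b) i z) :
    ∃ h : V → ℤ, h z = 0 ∧ 0 ≤ h ∧ ∀ i, i ≠ z → ∑ j, (B i j : ℤ) * (h j - h i) ≤ -1 := by
  obtain ⟨d, hz, hd⟩ := exists_rank _ z hB
  let D := ∑ i, d i
  have hD : ∀ i, d i ≤ D := fun i =>
    Finset.single_le_sum (fun _ _ => Nat.zero_le _) (Finset.mem_univ i)
  let M : ℤ := 1 + ∑ i, ∑ j, (B i j : ℤ)
  have hM : ∀ i, ∑ j, (B i j : ℤ) < M := fun i => by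
    have := Finset.single_le_sum (f := fun i => ∑ j, (B i j : ℤ))
      (fun _ _ => by positivity) (Finset.mem_univ i)
    lia
  have hM1 : 1 ≤ M := by
    have : 0 ≤ ∑ i, ∑ j, (B i j : ℤ) := by positivity
    lia
  refine ⟨fun i => M ^ D - M ^ (D - d i), by simp [hz],
    fun i => sub_nonneg.2 (pow_le_pow_right₀ hM1 (Nat.sub_le _ _)), fun i hi => ?_⟩
  obtain ⟨j, hj, hlt⟩ := hd i hi
  have hpos : 1 ≤ M ^ (D - d i) := one_le_pow₀ hM1
  have h1 : M * M ^ (D - d i) ≤ ∑ k, (B i k : ℤ) * M ^ (D - d k) := by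
    refine le_trans ?_ (Finset.single_le_sum (f := fun k => (B i k : ℤ) * M ^ (D - d k))
      (fun _ _ => by positivity) (Finset.mem_univ j))
    have h2 : M ^ (D - d i + 1) ≤ M ^ (D - d j) :=
      pow_le_pow_right₀ hM1 (by have := hD i; lia)
    have h3 : (1 : ℤ) ≤ B i j := by exact_mod_cast hj
    rw [pow_succ'] at h2
    nlinarith [pow_nonneg (zero_le_one.trans hM1) (D - d j)]
  have h2 : ∑ k, (B i k : ℤ) * ((M ^ D - M ^ (D - d k)) - (M ^ D - M ^ (D - d i)))
      = (∑ k, (B i k : ℤ)) * M ^ (D - d i) - ∑ k, (B i k : ℤ) * M ^ (D - d k) := by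
    rw [Finset.sum_mul, ← Finset.sum_sub_distrib]
    exact Finset.sum_congr rfl fun k _ => by ring
  rw [h2]
  nlinarith [hM i]

theorem exists_stable_off_sink {V : Type*} [Fintype V] {A : V → V → ℕ} (hA : Eulerian A)
    (hC : Connected A) (z : V) (s : V → ℤ) :
    ∃ u : V → ℤ, ∀ i, i ≠ z → (s + lap A u) i ≤ (deg A i : ℤ) - 1 := by
  obtain ⟨h, -, -, hh⟩ := exists_superharmonic (fun i j => A j i) z
    fun i => Relation.reflTransGen_swap.1 (hC z i)
  refine ⟨(∑ j, |s j| + 1) • h, fun i hi => ?_⟩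
  have h1 := hh i hi
  rw [← hA.lap_eq] at h1
  have h2 : lap A ((∑ j, |s j| + 1) • h) = (∑ j, |s j| + 1) • lap A h := map_zsmul (lapHom A) _ _
  have h3 := Finset.single_le_sum (f := fun j => |s j|) (fun j _ => abs_nonneg _)
        (Finset.mem_univ i)
  have h4 := le_abs_self (s i)
  have h5 : 0 ≤ |s i| := abs_nonneg _
  rw [h2, Pi.add_apply, Pi.smul_apply, smul_eq_mul]
  nlinarith

/-- Every sandpile has a `z`-recurrent decomposition. -/
theorem exists_zRec (hA : Eulerian A) (hC : Connected A) (z : V) (s : V → ℤ) :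
    ∃ (ρ : V → ℤ) (m : ℤ) (v : V → ℤ), ZRec A z ρ ∧ s = ρ + m • delta z + lap A v := by
  obtain ⟨h, hz, hnn, hh⟩ := exists_superharmonic A z fun i => hC i z
  let P : ℤ → Prop := fun x => ∃ (η : V → ℤ) (m : ℤ) (v : V → ℤ), s = η + m • delta z + lap A v ∧
    η z = deg A z ∧ (∀ i, i ≠ z → η i ≤ (deg A i : ℤ) - 1) ∧ x = ∑ i, h i * η i
  obtain ⟨u, hu⟩ := exists_stable_off_sink hA hC z s
  have hlap : lap A (fun _ => (1 : ℤ)) = 0 := hA.lap_const 1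
  -- resetting the height of the sink
  have hreset : ∀ η : V → ℤ, (∀ i, i ≠ z → η i ≤ (deg A i : ℤ) - 1) →
      ∀ v : V → ℤ, η = s + lap A v → P (∑ i, h i * η i) := by
    intro η hη v hv
    refine ⟨η + (deg A z - η z) • delta z, -(deg A z - η z), -v, ?_, ?_, fun i hi => ?_, ?_⟩
    · rw [lap_neg, neg_smul, hv]; abel
    · simp [delta]
    · simpa [delta, hi] using hη i hi
    · refine Finset.sum_congr rfl fun i _ => ?_
      by_cases hi : i = z
      · simp [hi, hz]
      · simp [delta, hi]
  obtain ⟨x, ⟨η, m, v, hs, hηz, hη, rfl⟩, hmax⟩ := Int.exists_greatest_of_bdd (P := P)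
    ⟨∑ i, h i * deg A i, by
      rintro _ ⟨η, m, v, -, h1, h2, rfl⟩
      refine Finset.sum_le_sum fun i _ => mul_le_mul_of_nonneg_left ?_ (hnn i)
      by_cases hi : i = z
      · rw [hi, h1]
      · have := h2 i hi
        lia⟩ ⟨_, hreset _ hu u rfl⟩
  have hstab : StableOff A (· = z) (η + lap A (delta z) + lap A ((fun _ => 1) - delta z)) := by
    rw [lap_sub, hlap]
    intro i hi
    simpa using hη i hi
  have hnonneg : 0 ≤ (fun _ => (1 : ℤ)) - delta z :=
    sub_delta_nonneg (fun _ => zero_le_one) le_rfl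
  obtain ⟨l, hl, hl'⟩ := stabilizableVia_of_stableOff hnonneg hstab
  have hcount := hl.count_le hnonneg hstab
  refine ⟨η, m, v, ⟨hηz, hη, l, ⟨hl, hl'⟩, ?_⟩, hs⟩
  rw [applySeq_eq] at hl'
  set c : V → ℤ := fun i => (l.count i : ℤ) with hc
  obtain ⟨η', m', v', hs', h1', h2', hx⟩ : P (∑ i, h i * (η + m • delta z
      + lap A (delta z + c)) i) :=
    hreset _ (fun i hi => by
      have := hl' i hi
      rw [add_assoc, ← lap_add] at this
      simpa [delta, hi] using this) (delta z + c - v) (by rw [hs, lap_sub]; abel)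
  have hle := hmax _ ⟨η', m', v', hs', h1', h2', rfl⟩
  rw [← hx] at hle
  simp only [Pi.add_apply, mul_add, Finset.sum_add_distrib, sum_mul_lap] at hle
  have hm : ∑ i, h i * (m • delta z) i = 0 := Finset.sum_eq_zero fun i _ => by
    by_cases hi : i = z
    · simp [hi, hz]
    · simp [delta, hi]
  set g : V → ℤ := fun i => ∑ j, (A i j : ℤ) * (h j - h i) with hg
  have hgsum : ∑ i, (1 : ℤ) * g i = 0 := by
    rw [hg, ← sum_mul_lap A h (fun _ => 1), hlap]
    simp
  have hcz : c z = 0 := by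
    have h0 := hcount z
    have h00 : 0 ≤ c z := by positivity
    simp only [Pi.sub_apply, delta, if_true] at h0
    lia
  have hterm : ∀ i, (1 - (delta z i + c i)) * g i ≤ 0 := fun i => by
    by_cases hi : i = z
    · simp [hi, delta, hcz]
    · have h1 := hcount i
      have h2 : g i ≤ -1 := hh i hi
      simp only [Pi.sub_apply, delta, hi, if_false] at h1 ⊢
      exact mul_nonpos_of_nonneg_of_nonpos (by simp only [hc]; lia) (by lia)
  have hzero : ∑ i, (1 - (delta z i + c i)) * g i = 0 := by
    refine le_antisymm (Finset.sum_nonpos fun i _ => hterm i) ?_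
    simp only [sub_mul, add_mul, Finset.sum_sub_distrib, Finset.sum_add_distrib] at hgsum ⊢
    simp only [Finset.sum_add_distrib, add_mul] at hle
    lia
  intro i hi
  have h1 := (Finset.sum_eq_zero_iff_of_nonpos fun i _ => hterm i).1 hzero i (Finset.mem_univ i)
  have h2 : g i ≤ -1 := hh i hi
  rcases mul_eq_zero.1 h1 with h3 | h3
  · simp only [delta, hi, if_false, hc] at h3
    lia
  · lia

theorem ZRec.unique {z : V} {ρ ρ' : V → ℤ} (hρ : ZRec A z ρ) (hρ' : ZRec A z ρ')
    (hA : Eulerian A) {m : ℤ} {v : V → ℤ} (h : ρ' = ρ + m • delta z + lap A v) : ρ' = ρ := by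
  have h1 := hρ.le_of_stable hA (m := m) (v := v) (by rw [← h]; exact hρ'.2.1)
  have h2 := hρ'.le_of_stable hA (m := -m) (v := -v) (by
    have h0 : ρ' + -m • delta z + lap A (-v) = ρ := by rw [h, lap_neg, neg_smul]; abel
    rw [h0]
    exact hρ.2.1)
  have hv : v = fun _ => v z := by
    ext i
    have := h2 i
    simp only [Pi.neg_apply] at this
    exact le_antisymm (by lia) (h1 i)
  rw [hv, hA.lap_const, add_zero] at h
  have hz := congrFun h z
  rw [hρ'.1, Pi.add_apply, hρ.1] at hz
  have : m = 0 := by simpa [delta] using hz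
  simpa [this] using h

/-- A sandpile is stabilizable iff the integer in its `z`-recurrent decomposition is negative. -/
theorem ZRec.stabilizable_iff {z : V} {ρ : V → ℤ} (hρ : ZRec A z ρ) (hA : Eulerian A) {m : ℤ}
    {v : V → ℤ} (h : s = ρ + m • delta z + lap A v) : Stabilizable A s ↔ m < 0 := by
  rw [hA.stabilizable_iff]
  constructor
  · rintro ⟨u, hu⟩
    rw [h, add_assoc, ← lap_add] at hu
    have h1 := hρ.le_of_stable hA fun i _ => hu i
    have h2 := hu z
    have h3 : 0 ≤ lap A (v + u) z := by
      rw [hA.lap_eq]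
      exact Finset.sum_nonneg fun j _ => mul_nonneg (by positivity) (sub_nonneg.2 (h1 j))
    simp only [Pi.add_apply, hρ.1, Pi.smul_apply, delta, if_true, smul_eq_mul] at h2
    lia
  · refine fun hm => ⟨-v, fun i => ?_⟩
    rw [h, lap_neg, add_neg_cancel_right]
    by_cases hi : i = z
    · simp only [hi, Pi.add_apply, hρ.1, Pi.smul_apply, delta, if_true, smul_eq_mul]
      lia
    · simpa [delta, hi] using hρ.2.1 i hi

theorem finite_zRec (hA : Eulerian A) (z : V) : Finite {ρ : V → ℤ // ZRec A z ρ} :=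
  (Set.finite_Icc (0 : V → ℤ) fun i => (deg A i : ℤ)).subset fun ρ hρ =>
    ⟨ZRec.nonneg hρ hA, fun i => by
      by_cases hi : i = z
      · rw [hi, hρ.1]
      · exact (hρ.2.1 i hi).trans (by lia)⟩

variable (A) in
/-- Sandpiles equivalent to zero: those generated by topplings and additions at the sink. -/
def sandpileRel (z : V) : AddSubgroup (V → ℤ) :=
  (lapHom A).range ⊔ AddSubgroup.zmultiples (delta z)

theorem mem_sandpileRel {z : V} :
    s ∈ sandpileRel A z ↔ ∃ (m : ℤ) (v : V → ℤ), s = m • delta z + lap A v := by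
  simp only [sandpileRel, AddSubgroup.mem_sup, AddMonoidHom.mem_range,
    AddSubgroup.mem_zmultiples_iff]
  constructor
  · rintro ⟨_, ⟨v, rfl⟩, _, ⟨m, rfl⟩, rfl⟩
    exact ⟨m, v, add_comm _ _⟩
  · rintro ⟨m, v, rfl⟩
    exact ⟨_, ⟨v, rfl⟩, _, ⟨m, rfl⟩, add_comm _ _⟩

variable (A) in
/-- The sandpile group of the graph with sink `z`. -/
abbrev SandpileGroup (z : V) : Type _ := (V → ℤ) ⧸ sandpileRel A z

/-- Every class of the sandpile group has a unique `z`-recurrent representative. -/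
def recEquiv (hA : Eulerian A) (hC : Connected A) (z : V) :
    {ρ : V → ℤ // ZRec A z ρ} ≃ SandpileGroup A z :=
  Equiv.ofBijective (fun ρ => QuotientAddGroup.mk ρ.1) <| by
    constructor
    · rintro ⟨ρ, hρ⟩ ⟨ρ', hρ'⟩ h
      obtain ⟨m, v, h⟩ := mem_sandpileRel.1 (QuotientAddGroup.eq.1 h)
      exact Subtype.ext (hρ.unique hρ' hA (m := m) (v := v)
        (by rw [add_assoc, ← h]; abel)).symm
    · intro g
      obtain ⟨s, rfl⟩ := QuotientAddGroup.mk_surjective g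
      obtain ⟨ρ, m, v, hρ, rfl⟩ := exists_zRec hA hC z s
      exact ⟨⟨ρ, hρ⟩, QuotientAddGroup.eq.2 (mem_sandpileRel.2 ⟨m, v, by simp only []; abel⟩)⟩

/-- The total mass of the recurrent representative of a class. -/
def recMass (hA : Eulerian A) (hC : Connected A) (z : V) (g : SandpileGroup A z) : ℤ :=
  totalMass ((recEquiv hA hC z).symm g).1

theorem stabilizable_iff_lt_recMass (hA : Eulerian A) (hC : Connected A) (z : V) (s : V → ℤ) :
    Stabilizable A s ↔ totalMass s < recMass hA hC z (QuotientAddGroup.mk s) := by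
  set ρ := (recEquiv hA hC z).symm (QuotientAddGroup.mk s) with hρ
  have h : (QuotientAddGroup.mk ρ.1 : SandpileGroup A z) = QuotientAddGroup.mk s :=
    (recEquiv hA hC z).apply_symm_apply _
  obtain ⟨m, v, h⟩ := mem_sandpileRel.1 (QuotientAddGroup.eq.1 h)
  have hs : s = ρ.1 + m • delta z + lap A v := by rw [add_assoc, ← h]; abel
  have hmass : totalMass s = totalMass ρ.1 + m := by
    rw [hs, totalMass_add, totalMass_add, totalMass_lap]
    simp [totalMass, delta]
  rw [ρ.2.stabilizable_iff hA hs, recMass, ← hρ, hmass]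
  lia

end Sandpile


section RandomWalk

variable {ι G : Type*} [Fintype ι] [AddCommGroup G]

/-- The transition operator of the random walk with steps `e i` of probability `α i`. -/
def walkOp (α : ι → ℝ) (e : ι → G) (f : G → ℝ) : G → ℝ := fun g => ∑ i, α i * f (g + e i)

variable {α : ι → ℝ} {e : ι → G}

theorem walkOp_mono (hα : ∀ i, 0 < α i) : Monotone (walkOp α e) := fun _ _ h _ =>
  Finset.sum_le_sum fun i _ => mul_le_mul_of_nonneg_left (h _) (hα i).le

theorem walkOp_const (hsum : ∑ i, α i = 1) (c : ℝ) :
    walkOp α e (fun _ => c) = fun _ => c := by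
  ext g
  simp [walkOp, ← Finset.sum_mul, hsum]

theorem walkOp_sub (f f' : G → ℝ) : walkOp α e (f - f') = walkOp α e f - walkOp α e f' := by
  ext g
  simp [walkOp, mul_sub]

theorem iterate_walkOp_const (hsum : ∑ i, α i = 1) (c : ℝ) (n : ℕ) :
    (walkOp α e)^[n] (fun _ => c) = fun _ => c :=
  Function.iterate_fixed (walkOp_const hsum c) n

theorem iterate_walkOp_sub (f f' : G → ℝ) (n : ℕ) :
    (walkOp α e)^[n] (f - f') = (walkOp α e)^[n] f - (walkOp α e)^[n] f' := by
  induction n generalizing f f' with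
  | zero => rfl
  | succ n ih => rw [Function.iterate_succ_apply, walkOp_sub, ih]; rfl

theorem sum_iterate_walkOp [Fintype G] (hsum : ∑ i, α i = 1) (f : G → ℝ) (n : ℕ) :
    ∑ g, (walkOp α e)^[n] f g = ∑ g, f g := by
  induction n generalizing f with
  | zero => rfl
  | succ n ih =>
    rw [Function.iterate_succ_apply, ih]
    simp only [walkOp]
    rw [Finset.sum_comm]
    simp only [← Finset.mul_sum]
    have h : ∀ i, ∑ g, f (g + e i) = ∑ g, f g := fun i =>
      Equiv.sum_comp (Equiv.addRight (e i)) f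
    simp only [h, ← Finset.sum_mul, hsum, one_mul]

/-- The walk started anywhere hits `0` after `n` steps with positive probability. -/
theorem exists_le_iterate_walkOp [Finite G] (hα : ∀ i, 0 < α i) (z : ι) (hz : e z = 0)
    (he : AddSubgroup.closure (Set.range e) = ⊤) :
    ∃ (n : ℕ) (c : ℝ), 0 < c ∧ ∀ f : G → ℝ, 0 ≤ f → ∀ g, c * f 0 ≤ (walkOp α e)^[n] f g := by
  have hnn : ∀ f : G → ℝ, 0 ≤ f → ∀ n, 0 ≤ (walkOp α e)^[n] f := fun f hf n => by
    induction n with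
    | zero => exact hf
    | succ n ih =>
      rw [Function.iterate_succ_apply']
      exact fun g => Finset.sum_nonneg fun i _ => mul_nonneg (hα i).le (ih _)
  have hstep : ∀ f : G → ℝ, 0 ≤ f → ∀ n g i,
      α i * (walkOp α e)^[n] f (g + e i) ≤ (walkOp α e)^[n + 1] f g := fun f hf n g i => by
    rw [Function.iterate_succ_apply']
    exact Finset.single_le_sum (f := fun i => α i * (walkOp α e)^[n] f (g + e i))
      (fun i _ => mul_nonneg (hα i).le (hnn f hf n _)) (Finset.mem_univ i)
  have hreach : ∀ g : G, ∃ (n : ℕ) (c : ℝ), 0 < c ∧ ∀ f : G → ℝ, 0 ≤ f →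
      c * f 0 ≤ (walkOp α e)^[n] f (-g) := fun g => by
    have hg : g ∈ AddSubmonoid.closure (Set.range e) := by
      rw [← AddSubgroup.closure_toAddSubmonoid_of_finite, he]
      trivial
    induction hg using AddSubmonoid.closure_induction_left with
    | zero => exact ⟨0, 1, one_pos, fun f _ => by simp⟩
    | add_left x hx y _ ih =>
      obtain ⟨i, rfl⟩ := hx
      obtain ⟨n, c, hc, h⟩ := ih
      refine ⟨n + 1, α i * c, mul_pos (hα i) hc, fun f hf => ?_⟩
      refine le_trans ?_ (hstep f hf n _ i)
      rw [neg_add_rev, neg_add_cancel_right, mul_assoc]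
      exact mul_le_mul_of_nonneg_left (h f hf) (hα i).le
  choose n c hc h using hreach
  have hlazy : ∀ g : G, ∀ m, n g ≤ m → ∃ c : ℝ, 0 < c ∧ ∀ f : G → ℝ, 0 ≤ f →
      c * f 0 ≤ (walkOp α e)^[m] f (-g) := fun g m hm => by
    induction m, hm using Nat.le_induction with
    | base => exact ⟨c g, hc g, h g⟩
    | succ m _ ih =>
      obtain ⟨c, hc, h⟩ := ih
      refine ⟨α z * c, mul_pos (hα z) hc, fun f hf => ?_⟩
      refine le_trans ?_ (hstep f hf m _ z)
      rw [hz, add_zero, mul_assoc]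
      exact mul_le_mul_of_nonneg_left (h f hf) (hα z).le
  obtain ⟨N, hN⟩ := Finite.exists_le n
  choose c hc h using fun g => hlazy g N (hN g)
  obtain ⟨g₀, hg₀⟩ := Finite.exists_min c
  refine ⟨N, c g₀, hc g₀, fun f hf g => ?_⟩
  have h1 := h (-g) f hf
  rw [neg_neg] at h1
  exact (mul_le_mul_of_nonneg_right (hg₀ _) (hf 0)).trans h1

/-- Convergence to the uniform distribution of a lazy random walk on a finite abelian group,
uniformly in the starting point. -/
theorem tendsto_iterate_walkOp [Fintype G] (hα : ∀ i, 0 < α i) (hsum : ∑ i, α i = 1) (z : ι)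
    (hz : e z = 0) (he : AddSubgroup.closure (Set.range e) = ⊤) (f : G → ℝ) {ε : ℝ}
    (hε : 0 < ε) : ∃ K : ℕ, ∀ k, K ≤ k → ∀ g,
      |(walkOp α e)^[k] f g - (∑ x, f x) / Fintype.card G| ≤ ε := by
  obtain ⟨N, c, hc, hN⟩ := exists_le_iterate_walkOp hα z hz he
  have hmono : ∀ n, Monotone (walkOp α e)^[n] := fun n => (walkOp_mono hα).iterate n
  -- the width of an interval containing all values contracts
  have hcontr : ∀ (f : G → ℝ) (a b : ℝ), (∀ g, a ≤ f g ∧ f g ≤ b) → ∃ a' b',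
      (∀ g, a' ≤ (walkOp α e)^[N] f g ∧ (walkOp α e)^[N] f g ≤ b') ∧
        b' - a' = (1 - c) * (b - a) := fun f a b hf => by
    refine ⟨a + c * (f 0 - a), b - c * (b - f 0), fun g => ⟨?_, ?_⟩, by ring⟩
    · have := hN (f - fun _ => a) (fun g => sub_nonneg.2 (hf g).1) g
      rw [iterate_walkOp_sub, iterate_walkOp_const hsum] at this
      simp only [Pi.sub_apply] at this
      linarith
    · have := hN ((fun _ => b) - f) (fun g => sub_nonneg.2 (hf g).2) g
      rw [iterate_walkOp_sub, iterate_walkOp_const hsum] at this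
      simp only [Pi.sub_apply] at this
      linarith
  have hc1 : c ≤ 1 := by
    have := hN (fun _ => 1) (fun _ => zero_le_one) 0
    rwa [iterate_walkOp_const hsum, mul_one] at this
  obtain ⟨a, ha⟩ := Finite.exists_ge f
  obtain ⟨b, hb⟩ := Finite.exists_le f
  have hinterval : ∀ m : ℕ, ∃ a' b', (∀ g, a' ≤ (walkOp α e)^[N * m] f g ∧
      (walkOp α e)^[N * m] f g ≤ b') ∧ b' - a' = (1 - c) ^ m * (b - a) := fun m => by
    induction m with
    | zero => exact ⟨a, b, fun g => ⟨ha g, hb g⟩, by simp⟩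
    | succ m ih =>
      obtain ⟨a', b', h, hw⟩ := ih
      obtain ⟨a'', b'', h', hw'⟩ := hcontr _ a' b' h
      refine ⟨a'', b'', fun g => ?_, by rw [hw', hw, pow_succ']; ring⟩
      rw [mul_add_one, add_comm, Function.iterate_add_apply]
      exact h' g
  have hlim : Tendsto (fun m : ℕ => (1 - c) ^ m * (b - a)) atTop (nhds 0) := by
    simpa using (tendsto_pow_atTop_nhds_zero_of_lt_one (sub_nonneg.2 hc1)
      (sub_lt_self 1 hc)).mul_const (b - a)
  obtain ⟨m, hm⟩ := (hlim.eventually_le_const hε).exists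
  obtain ⟨a', b', h, hw⟩ := hinterval m
  refine ⟨N * m, fun k hk g => ?_⟩
  have hk' : ∀ g, a' ≤ (walkOp α e)^[k] f g ∧ (walkOp α e)^[k] f g ≤ b' := fun g => by
    obtain ⟨j, rfl⟩ := Nat.exists_eq_add_of_le' hk
    rw [Function.iterate_add_apply]
    constructor
    · have := hmono j (fun g => (h g).1 : (fun _ => a') ≤ (walkOp α e)^[N * m] f) g
      rwa [iterate_walkOp_const hsum] at this
    · have := hmono j (fun g => (h g).2 : (walkOp α e)^[N * m] f ≤ fun _ => b') g
      rwa [iterate_walkOp_const hsum] at this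
  have hcard : (0 : ℝ) < Fintype.card G := by exact_mod_cast Fintype.card_pos
  have h1 : a' ≤ (∑ x, f x) / Fintype.card G := by
    rw [le_div_iff₀ hcard, ← sum_iterate_walkOp (e := e) hsum f k, mul_comm, ← nsmul_eq_mul]
    exact Finset.card_nsmul_le_sum _ _ _ fun g _ => (hk' g).1
  have h2 : (∑ x, f x) / Fintype.card G ≤ b' := by
    rw [div_le_iff₀ hcard, ← sum_iterate_walkOp (e := e) hsum f k, mul_comm, ← nsmul_eq_mul]
    exact Finset.sum_le_card_nsmul _ _ _ fun g _ => (hk' g).2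
  have h3 := hk' g
  rw [abs_le]
  constructor <;> linarith

end RandomWalk

section Words

variable {V : Type*} [Fintype V] [DecidableEq V]

/-- The words of length `k`. -/
def words (V : Type*) [Fintype V] [DecidableEq V] : ℕ → Finset (List V)
  | 0 => {[]}
  | k + 1 => (Finset.univ ×ˢ words V k).image fun p => p.1 :: p.2

theorem mem_words {k : ℕ} {w : List V} : w ∈ words V k ↔ w.length = k := by
  induction k generalizing w with
  | zero => simp [words]
  | succ k ih => cases w <;> simp [words, ih]

theorem sum_words_succ (k : ℕ) (f : List V → ℝ) :
    ∑ w ∈ words V (k + 1), f w = ∑ i, ∑ w ∈ words V k, f (i :: w) := by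
  rw [words, Finset.sum_image (by rintro ⟨i, w⟩ _ ⟨j, w'⟩ _ h; simpa using h),
    Finset.sum_product]

variable (α : V → ℝ)

theorem sum_words_wordProb_succ (k : ℕ) (f : List V → ℝ) :
    ∑ w ∈ words V (k + 1), wordProb α w * f w
      = ∑ i, α i * ∑ w ∈ words V k, wordProb α w * f (i :: w) := by
  simp only [sum_words_succ, wordProb, List.map_cons, List.prod_cons, mul_assoc, Finset.mul_sum]

theorem sum_words_dropLast {α : V → ℝ} (hsum : ∑ i, α i = 1) (k : ℕ) (f : List V → ℝ) :
    ∑ w ∈ words V (k + 1), wordProb α w * f w.dropLast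
      = ∑ w ∈ words V k, wordProb α w * f w := by
  induction k generalizing f with
  | zero =>
    rw [sum_words_wordProb_succ]
    simp [words, wordProb, ← Finset.sum_mul, hsum]
  | succ k ih =>
    rw [sum_words_wordProb_succ, sum_words_wordProb_succ]
    refine Finset.sum_congr rfl fun i _ => congrArg _ ?_
    rw [← ih fun w => f (i :: w)]
    refine Finset.sum_congr rfl fun w hw => ?_
    rw [List.dropLast_cons_of_ne_nil]
    rintro rfl
    simp [mem_words] at hw

/-- The expectation of a function of the position of the walk as a sum over words. -/
theorem sum_words_walk {G : Type*} [AddCommGroup G] (e : V → G) (f : G → ℝ) (k : ℕ) (g : G) :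
    ∑ w ∈ words V k, wordProb α w * f (g + (w.map e).sum) = (walkOp α e)^[k] f g := by
  induction k generalizing g with
  | zero => simp [words, wordProb]
  | succ k ih =>
    rw [sum_words_wordProb_succ, Function.iterate_succ_apply', walkOp]
    simp only [List.map_cons, List.sum_cons, ← add_assoc, ih]

end Words

section Chain

variable {V : Type*} [Fintype V] [DecidableEq V] {A : V → V → ℕ}

theorem chain_concat (s₀ : V → ℤ) (w : List V) (i : V) :
    chain A s₀ (w ++ [i]) = closedAdd A i (chain A s₀ w) := by
  simp [chain]

theorem exists_closedAdd_eq (i : V) (s : V → ℤ) :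
    ∃ u, closedAdd A i s = s + delta i + lap A u := by
  unfold closedAdd
  split_ifs
  · exact ⟨_, applySeq_eq _⟩
  · exact ⟨0, by rw [lap_zero, add_zero]; rfl⟩

theorem totalMass_closedAdd (i : V) (s : V → ℤ) :
    totalMass (closedAdd A i s) = totalMass s + 1 := by
  obtain ⟨u, hu⟩ := exists_closedAdd_eq (A := A) i s
  rw [hu, totalMass_add, totalMass_add, totalMass_lap, totalMass_delta, add_zero]

theorem totalMass_chain (s₀ : V → ℤ) (w : List V) :
    totalMass (chain A s₀ w) = totalMass s₀ + w.length := by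
  induction w using List.reverseRecOn with
  | nil => simp [chain]
  | append_singleton w i ih =>
    rw [chain_concat, totalMass_closedAdd, ih]
    simp [add_assoc]

theorem mk_chain (z : V) (s₀ : V → ℤ) (w : List V) :
    (QuotientAddGroup.mk (chain A s₀ w) : SandpileGroup A z)
      = QuotientAddGroup.mk s₀ + (w.map fun i => QuotientAddGroup.mk (delta i)).sum := by
  induction w using List.reverseRecOn with
  | nil => simp [chain]
  | append_singleton w i ih =>
    obtain ⟨u, hu⟩ := exists_closedAdd_eq (A := A) i (chain A s₀ w)
    have hu0 : (QuotientAddGroup.mk (lap A u) : SandpileGroup A z) = 0 :=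
      (QuotientAddGroup.eq_zero_iff _).2 (mem_sandpileRel.2 ⟨0, u, by simp⟩)
    rw [chain_concat, hu, QuotientAddGroup.mk_add, QuotientAddGroup.mk_add, ih, hu0]
    simp [add_assoc]

theorem Stabilizable.of_closedAdd (hA : Eulerian A) {s : V → ℤ} {i : V}
    (h : Stabilizable A (closedAdd A i s)) : Stabilizable A s := by
  obtain ⟨u, hu⟩ := exists_closedAdd_eq (A := A) i s
  rw [hA.stabilizable_iff] at h ⊢
  obtain ⟨v, hv⟩ := h
  refine ⟨u + v, fun j => le_trans ?_ (hv j)⟩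
  have : 0 ≤ (delta i : V → ℤ) j := by unfold delta; split_ifs <;> simp
  rw [hu, lap_add]
  simp only [Pi.add_apply]
  lia

theorem Stabilizable.of_prefix (hA : Eulerian A) {s₀ : V → ℤ} {w w' : List V}
    (h : Stabilizable A (chain A s₀ w)) (hw : w' <+: w) : Stabilizable A (chain A s₀ w') := by
  obtain ⟨t, rfl⟩ := hw
  induction t using List.reverseRecOn with
  | nil => simpa using h
  | append_singleton t i ih =>
    rw [← List.append_assoc, chain_concat] at h
    exact ih (h.of_closedAdd hA)

theorem isThresholdWord_iff (hA : Eulerian A) {s₀ : V → ℤ} {w : List V} (hw : w ≠ []) :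
    IsThresholdWord A s₀ w ↔
      ¬ Stabilizable A (chain A s₀ w) ∧ Stabilizable A (chain A s₀ w.dropLast) := by
  refine and_congr_right fun _ => ⟨fun h => h _ (List.dropLast_prefix w) fun h' => ?_,
    fun h w' hpre hne => h.of_prefix hA ?_⟩
  · have := congrArg List.length h'
    have := List.length_pos_of_ne_nil hw
    simp at *
    lia
  · rw [← List.dropLast_append_getLast hw, List.prefix_concat_iff,
      List.dropLast_append_getLast hw] at hpre
    exact hpre.resolve_left hne

theorem closure_range_mk_delta (z : V) :
    AddSubgroup.closure
      (Set.range fun i => (QuotientAddGroup.mk (delta i) : SandpileGroup A z)) = ⊤ := by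
  refine eq_top_iff.2 fun g _ => ?_
  obtain ⟨s, rfl⟩ := QuotientAddGroup.mk_surjective g
  have hs : s = ∑ i, s i • delta i := by
    ext j
    simp [delta, Finset.sum_apply]
  rw [hs, ← QuotientAddGroup.mk'_apply, map_sum]
  refine AddSubgroup.sum_mem _ fun i _ => ?_
  rw [map_zsmul]
  exact AddSubgroup.zsmul_mem _ (AddSubgroup.subset_closure (Set.mem_range_self i)) _

/-- The probability that the threshold mass is `n` as a difference of two transition
probabilities of the random walk on the sandpile group. -/
theorem thresholdProb_totalMass_eq (hA : Eulerian A) (hC : Connected A) {α : V → ℝ}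
    (hsum : ∑ i, α i = 1) (z : V) (n k : ℕ) (s₀ : V → ℤ) (hk : totalMass s₀ + (k + 1) = n) :
    thresholdProb A α s₀ (fun w => totalMass (chain A s₀ w) = (n : ℤ))
      = (walkOp α fun i => (QuotientAddGroup.mk (delta i) : SandpileGroup A z))^[k + 1]
          (fun g => if recMass hA hC z g ≤ n then 1 else 0) (QuotientAddGroup.mk s₀)
        - (walkOp α fun i => (QuotientAddGroup.mk (delta i) : SandpileGroup A z))^[k]
          (fun g => if recMass hA hC z g ≤ n - 1 then 1 else 0) (QuotientAddGroup.mk s₀) := by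
  have hmass : ∀ w : List V, totalMass (chain A s₀ w) = n ↔ w.length = k + 1 := fun w => by
    rw [totalMass_chain]; lia
  have hind : ∀ w : List V, ∀ m : ℤ, totalMass (chain A s₀ w) = m →
      (if recMass hA hC z (QuotientAddGroup.mk s₀
        + (w.map fun i => QuotientAddGroup.mk (delta i)).sum) ≤ m then (1 : ℝ) else 0)
      = if Stabilizable A (chain A s₀ w) then 0 else 1 := fun w m hw => by
    simp only [stabilizable_iff_lt_recMass hA hC z, ← mk_chain, hw, ← not_le, ite_not]
  refine (tsum_eq_sum (s := words V (k + 1)) fun w hw => if_neg fun h =>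
    hw (mem_words.2 ((hmass w).1 h.2))).trans ?_
  rw [← sum_words_walk, ← sum_words_walk,
    Finset.sum_congr (s₁ := words V k) rfl fun w hw => by
      rw [hind w _ (by rw [totalMass_chain, mem_words.1 hw]; lia)],
    ← sum_words_dropLast hsum k, ← Finset.sum_sub_distrib]
  refine Finset.sum_congr rfl fun w hw => ?_
  have hlen := mem_words.1 hw
  have hne : w ≠ [] := by rintro rfl; simp at hlen
  rw [hind w n ((hmass w).2 hlen), isThresholdWord_iff hA hne, ← mul_sub]
  simp only [(hmass w).2 hlen, and_true]
  have hpre := fun h : Stabilizable A (chain A s₀ w) => h.of_prefix hA (List.dropLast_prefix w)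
  by_cases h1 : Stabilizable A (chain A s₀ w)
  · simp [h1, hpre h1]
  · by_cases h2 : Stabilizable A (chain A s₀ w.dropLast) <;> simp [h1, h2]

end Chain

end ThresholdState

open ThresholdState in
/-- `P_{s0}(|s_τ| = n) → (1/κ)·#{ρ ∈ Rec(z) : |ρ| = n}` as `|s₀| → -∞`. -/
theorem statement_3 {V : Type*} [Fintype V] [DecidableEq V]
    (A : V → V → ℕ) (hEul : Eulerian A) (hConn : Connected A)
    (α : V → ℝ) (hαpos : ∀ j, 0 < α j) (hαsum : ∑ j, α j = 1)
    (n : ℕ) (z : V) :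
    ∀ ε : ℝ, 0 < ε → ∃ K : ℤ, K < 0 ∧ ∀ s0 : V → ℤ, totalMass s0 < K →
      |thresholdProb A α s0 (fun w => totalMass (chain A s0 w) = (n : ℤ))
        - (1 / (kappa A z : ℝ)) *
            (Nat.card {ρ : V → ℤ // ZRec A z ρ ∧ totalMass ρ = (n : ℤ)} : ℝ)| ≤ ε := by
  intro ε hε
  have hfin : Finite (SandpileGroup A z) :=
    have := finite_zRec hEul z
    Finite.of_equiv _ (recEquiv hEul hConn z)
  let _ : Fintype (SandpileGroup A z) := Fintype.ofFinite _
  have hz : (QuotientAddGroup.mk (delta z) : SandpileGroup A z) = 0 :=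
    (QuotientAddGroup.eq_zero_iff _).2 (mem_sandpileRel.2 ⟨1, 0, by simp [lap_zero]⟩)
  have hlim := fun f => tendsto_iterate_walkOp (f := f) hαpos hαsum z hz
    (closure_range_mk_delta (A := A) z) (half_pos hε)
  obtain ⟨K₁, h₁⟩ := hlim fun g => if recMass hEul hConn z g ≤ n then 1 else 0
  obtain ⟨K₂, h₂⟩ := hlim fun g => if recMass hEul hConn z g ≤ n - 1 then 1 else 0
  have hκ : kappa A z = Fintype.card (SandpileGroup A z) := by
    rw [kappa, Nat.card_congr (recEquiv hEul hConn z), Nat.card_eq_fintype_card]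
  have hcard : (Nat.card {ρ : V → ℤ // ZRec A z ρ ∧ totalMass ρ = (n : ℤ)} : ℝ)
      = (∑ g, if recMass hEul hConn z g ≤ n then (1 : ℝ) else 0)
        - ∑ g, if recMass hEul hConn z g ≤ n - 1 then (1 : ℝ) else 0 := by
    have h : Nat.card {ρ : V → ℤ // ZRec A z ρ ∧ totalMass ρ = (n : ℤ)}
        = Nat.card {g // recMass hEul hConn z g = n} :=
      Nat.card_congr <| (Equiv.subtypeSubtypeEquivSubtypeInter _ _).symm.trans <|
        (recEquiv hEul hConn z).subtypeEquiv fun ρ => by simp [recMass]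
    rw [h, Nat.card_eq_fintype_card, Fintype.card_subtype, ← Finset.sum_sub_distrib,
      Finset.card_filter, Nat.cast_sum]
    refine Finset.sum_congr rfl fun g _ => ?_
    split_ifs <;> first | lia | simp
  refine ⟨-(K₁ + K₂ + 1), by lia, fun s₀ hs₀ => ?_⟩
  obtain ⟨k, hk⟩ : ∃ k : ℕ, n - totalMass s₀ - 1 = k := Int.eq_ofNat_of_zero_le (by lia)
  rw [thresholdProb_totalMass_eq hEul hConn hαsum z n k s₀ (by lia), hcard, hκ, one_div,
    inv_mul_eq_div, sub_div]
  have h₁' := abs_le.1 (h₁ (k + 1) (by lia) (QuotientAddGroup.mk s₀))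
  have h₂' := abs_le.1 (h₂ k (by lia) (QuotientAddGroup.mk s₀))
  rw [abs_le]
  constructor <;> linarith
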